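/- arXiv:0907.1439 — 9 statements merged into one kernel-verified Lean document; each statement's English description precedes it below -/
import Mathlib

section
/- Let S be a densely defined, closed, symmetric operator in H with S ≥ ε I for some ε > 0. Then dom(S_K) = dom(S) ∔ ker(S*) (a direct sum of subspaces with trivial intersection), where S_K is the Krein–von Neumann extension of S. -/
open Filter Topology

noncomputable section

variable {H : Type*} [NormedAddCommGroup H] [InnerProductSpace ℂ H] [CompleteSpace H]

local notation "⟪" x ", " y "⟫" => @inner ℂ _ _ x y

/-- Standing hypothesis: `S` is densely defined, closed, symmetric, and `S ≥ ε`. -/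
structure StandingHyp (S : H →ₗ.[ℂ] H) (ε : ℝ) : Prop where
  dense : Dense (S.domain : Set H)
  closed : S.IsClosed
  symmetric : ∀ u v : S.domain, ⟪(S u : H), (v : H)⟫ = ⟪(u : H), (S v : H)⟫
  pos : 0 < ε
  lower : ∀ u : S.domain, ε * ‖(u : H)‖ ^ 2 ≤ (⟪(u : H), (S u : H)⟫).re

/-- Krein–von Neumann extension, via the Ando–Nishio intrinsic description. -/
def IsKreinVonNeumannExtension (S Sk : H →ₗ.[ℂ] H) : Prop :=
  Sk ≤ S.adjoint ∧
  ∀ v : H, v ∈ Sk.domain ↔ ∃ hv : v ∈ S.adjoint.domain, ∃ f : ℕ → S.domain,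
    Tendsto (fun j => (S (f j) : H)) atTop (nhds (S.adjoint ⟨v, hv⟩)) ∧
    ∀ δ : ℝ, 0 < δ → ∃ N : ℕ, ∀ j ≥ N, ∀ k ≥ N,
      ‖⟪((f j - f k : S.domain) : H), (S (f j - f k) : H)⟫‖ < δ

/-- Friedrichs extension, via Freudenthal's intrinsic description. -/
def IsFriedrichsExtension (S Sf : H →ₗ.[ℂ] H) : Prop :=
  Sf ≤ S.adjoint ∧
  ∀ v : H, v ∈ Sf.domain ↔ v ∈ S.adjoint.domain ∧ ∃ f : ℕ → S.domain,
    Tendsto (fun j => ((f j : H))) atTop (nhds v) ∧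
    ∀ δ : ℝ, 0 < δ → ∃ N : ℕ, ∀ j ≥ N, ∀ k ≥ N,
      ‖⟪((f j - f k : S.domain) : H), (S (f j - f k) : H)⟫‖ < δ

/-- The kernel of a partially defined operator, as a submodule of `H`. -/
def pKer (A : H →ₗ.[ℂ] H) : Submodule ℂ H :=
  (LinearMap.ker A.toFun).map A.domain.subtype

/-- `q` is the orthogonal projection of `u` onto `Kᗮ`. -/
def IsOrthProjOn (K : Submodule ℂ H) (u q : H) : Prop :=
  q ∈ Kᗮ ∧ u - q ∈ Kᗮᗮ
/-- `dom S_K = dom S ∔ ker S*` (direct sum with trivial intersection). -/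
theorem kreinExtension_domain_decomposition
    (S Sk : H →ₗ.[ℂ] H) (ε : ℝ) (hS : StandingHyp S ε)
    (hK : IsKreinVonNeumannExtension S Sk) :
    (∀ v : H, v ∈ Sk.domain → ∃ u w : H, u ∈ S.domain ∧
        (∃ hw : w ∈ S.adjoint.domain, S.adjoint ⟨w, hw⟩ = 0) ∧ v = u + w) ∧
    (∀ u w : H, u ∈ S.domain → (∃ hw : w ∈ S.adjoint.domain, S.adjoint ⟨w, hw⟩ = 0) →
        u + w ∈ Sk.domain) ∧
    (∀ x : H, x ∈ S.domain → (∃ hx : x ∈ S.adjoint.domain, S.adjoint ⟨x, hx⟩ = 0) →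
        x = 0) := by
  have hle : S ≤ S.adjoint :=
    LinearPMap.IsFormalAdjoint.le_adjoint hS.dense (fun u v => hS.symmetric u v)
  have hval : ∀ (u : S.domain) (h : (u : H) ∈ S.adjoint.domain),
      S.adjoint ⟨(u : H), h⟩ = S u := fun u h => (hle.2 (x := u) (y := ⟨u, h⟩) rfl).symm
  have hbd : ∀ u : S.domain, ε * ‖(u : H)‖ ≤ ‖S u‖ := by
    intro u
    have h1 := hS.lower u
    have h2 : (⟪(u : H), (S u : H)⟫).re ≤ ‖(u : H)‖ * ‖S u‖ :=
      (Complex.re_le_norm _).trans (norm_inner_le_norm _ _)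
    rcases (norm_nonneg (u : H)).eq_or_lt with h0 | h0
    · rw [← h0]; simp
    · have h3 : ‖(u : H)‖ * (ε * ‖(u : H)‖) ≤ ‖(u : H)‖ * ‖S u‖ := by nlinarith
      exact le_of_mul_le_mul_left h3 h0
  refine ⟨?_, ?_, ?_⟩
  · intro v hv
    obtain ⟨hv, f, hf, -⟩ := (hK.2 v).1 hv
    have hc : CauchySeq (fun j => ((f j : S.domain) : H)) := by
      rw [Metric.cauchySeq_iff]
      intro δ hδ
      obtain ⟨N, hN⟩ := Metric.cauchySeq_iff.1 hf.cauchySeq (ε * δ) (mul_pos hS.pos hδ)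
      refine ⟨N, fun m hm n hn => ?_⟩
      have h1 := hN m hm n hn
      have h2 := hbd (f m - f n)
      rw [LinearPMap.map_sub] at h2
      rw [dist_eq_norm] at h1 ⊢
      exact lt_of_mul_lt_mul_left (h2.trans_lt h1) hS.pos.le
    obtain ⟨u, hu⟩ := cauchySeq_tendsto_of_complete hc
    have hg : (u, S.adjoint ⟨v, hv⟩) ∈ S.graph := by
      refine hS.closed.mem_of_tendsto (hu.prodMk_nhds hf) (Eventually.of_forall fun j => ?_)
      exact S.mem_graph (f j)
    obtain ⟨y, hy1, hy2⟩ := (LinearPMap.mem_graph_iff S).1 hg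
    simp only at hy1 hy2
    subst hy1
    have hyd : (y : H) ∈ S.adjoint.domain := hle.1 y.2
    refine ⟨y, v - y, y.2, ⟨S.adjoint.domain.sub_mem hv hyd, ?_⟩, by abel⟩
    have := LinearPMap.map_sub S.adjoint ⟨v, hv⟩ ⟨y, hyd⟩
    rw [hval y hyd, hy2, sub_self] at this
    exact this
  · rintro u w hu ⟨hw, hw0⟩
    have hud : u ∈ S.adjoint.domain := hle.1 hu
    refine (hK.2 _).2 ⟨S.adjoint.domain.add_mem hud hw, fun _ => ⟨u, hu⟩, ?_, ?_⟩
    · have h := LinearPMap.map_add S.adjoint ⟨u, hud⟩ ⟨w, hw⟩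
      rw [hval ⟨u, hu⟩ hud, hw0, add_zero] at h
      have h' : S.adjoint ⟨u + w, S.adjoint.domain.add_mem hud hw⟩ = S ⟨u, hu⟩ := h
      rw [h']
      exact tendsto_const_nhds
    · intro δ hδ
      exact ⟨0, fun _ _ _ _ => by simpa using hδ⟩
  · rintro x hx ⟨hxd, h0⟩
    have h1 := hbd ⟨x, hx⟩
    rw [← hval ⟨x, hx⟩ hxd, h0, norm_zero] at h1
    have h2 : ‖x‖ ≤ 0 := by
      have := hS.pos
      by_contra hn
      push Not at hn
      have := mul_pos hS.pos hn
      exact absurd h1 (not_le.2 this)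
    exact norm_le_zero_iff.1 h2
end
end

section
/- Let S be a densely defined, closed, symmetric operator in H with S ≥ ε I for some ε > 0, S_F its Friedrichs extension, S_K its Krein–von Neumann extension, and P the orthogonal projection of H onto ker(S_K). Then the inverse of the reduced Krein–von Neumann operator Ŝ_K = S_K restricted to (ker S_K)^⊥ satisfies (Ŝ_K)^{-1} = (I - P)(S_F)^{-1}(I - P) as operators on (ker S_K)^⊥. -/
open Filter Topology

noncomputable section

variable {H : Type*} [NormedAddCommGroup H] [InnerProductSpace ℂ H] [CompleteSpace H]

local notation "⟪" x ", " y "⟫" => @inner ℂ _ _ x y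

/-- Krein's formula `(Ŝ_K)⁻¹ = (I - P) (S_F)⁻¹ (I - P)` on `Ĥ = (ker S_K)ᗮ`:
for `v ∈ dom S_K ∩ (ker S_K)ᗮ` there is `x ∈ dom S_F` with `S_F x = S_K v`, and for any
such `x`, the vector `v` is the orthogonal projection of `x` onto `(ker S_K)ᗮ`. -/
theorem reduced_krein_inverse_eq_projected_friedrichs_inverse
    (S Sf Sk : H →ₗ.[ℂ] H) (ε : ℝ) (hS : StandingHyp S ε)
    (hF : IsFriedrichsExtension S Sf) (hK : IsKreinVonNeumannExtension S Sk)
    (v : H) (hv : v ∈ Sk.domain) (hvperp : v ∈ (pKer Sk)ᗮ) :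
    (∃ x : H, ∃ hx : x ∈ Sf.domain, Sf ⟨x, hx⟩ = Sk ⟨v, hv⟩) ∧
    (∀ (x : H) (hx : x ∈ Sf.domain), Sf ⟨x, hx⟩ = Sk ⟨v, hv⟩ →
      IsOrthProjOn (pKer Sk) x v) := by
  obtain ⟨hFle, hFdom⟩ := hF
  obtain ⟨hKle, hKdom⟩ := hK
  have hSadj : S ≤ S.adjoint :=
    LinearPMap.IsFormalAdjoint.le_adjoint hS.dense (fun u w => hS.symmetric u w)
  refine ⟨?_, ?_⟩
  · obtain ⟨hv', f, hf, hc⟩ := (hKdom v).1 hv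
    have hkv : Sk ⟨v, hv⟩ = S.adjoint ⟨v, hv'⟩ := hKle.2 rfl
    have hcau : CauchySeq (fun j => ((f j : S.domain) : H)) := by
      rw [Metric.cauchySeq_iff]
      intro δ hδ
      obtain ⟨N, hN⟩ := hc (ε * δ ^ 2) (mul_pos hS.pos (by positivity))
      refine ⟨N, fun m hm n hn => ?_⟩
      have h1 := hN m hm n hn
      have h2 := hS.lower (f m - f n)
      have h3 := (Complex.re_le_norm _).trans_lt h1
      have h4 := lt_of_mul_lt_mul_left (h2.trans_lt h3) hS.pos.le
      have h5 := lt_of_pow_lt_pow_left₀ 2 hδ.le h4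
      rw [dist_eq_norm]
      exact h5
    obtain ⟨x, hx⟩ := cauchySeq_tendsto_of_complete hcau
    have hmem : (x, S.adjoint ⟨v, hv'⟩) ∈ S.graph := by
      refine IsClosed.mem_of_tendsto (f := fun j => (((f j : S.domain) : H), S (f j)))
        (b := atTop) hS.closed (hx.prodMk_nhds hf) (Eventually.of_forall fun j => ?_)
      exact S.mem_graph (f j)
    obtain ⟨y, hy1, hy2⟩ := (LinearPMap.mem_graph_iff S).1 hmem
    have hy1' : (y : H) = x := hy1
    have hy2' : S y = S.adjoint ⟨v, hv'⟩ := hy2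
    have hyF : (y : H) ∈ Sf.domain := by
      refine (hFdom y).2 ⟨hSadj.1 y.2, fun _ => y, tendsto_const_nhds, fun δ hδ => ⟨0, ?_⟩⟩
      intro j _ k _
      simpa using hδ
    refine ⟨y, hyF, ?_⟩
    rw [hkv, ← hy2']
    have e1 : Sf ⟨y, hyF⟩ = S.adjoint ⟨y, hSadj.1 y.2⟩ := hFle.2 rfl
    have e2 : S y = S.adjoint ⟨y, hSadj.1 y.2⟩ := hSadj.2 rfl
    rw [e1, e2]
  · intro x hx hxv
    refine ⟨hvperp, Submodule.le_orthogonal_orthogonal _ ?_⟩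
    have e1 : Sf ⟨x, hx⟩ = S.adjoint ⟨x, hFle.1 hx⟩ := hFle.2 rfl
    have e2 : Sk ⟨v, hv⟩ = S.adjoint ⟨v, hKle.1 hv⟩ := hKle.2 rfl
    have hw : x - v ∈ S.adjoint.domain := S.adjoint.domain.sub_mem (hFle.1 hx) (hKle.1 hv)
    have e3 : S.adjoint ⟨x - v, hw⟩ = 0 := by
      have := S.adjoint.map_sub ⟨x, hFle.1 hx⟩ ⟨v, hKle.1 hv⟩
      rw [← e1, ← e2, hxv, sub_self] at this
      exact this
    have hwK : x - v ∈ Sk.domain := by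
      refine (hKdom _).2 ⟨hw, fun _ => 0, ?_, fun δ hδ => ⟨0, ?_⟩⟩
      · rw [e3]
        simp
      · intro j _ k _
        simpa using hδ
    have e4 : Sk ⟨x - v, hwK⟩ = S.adjoint ⟨x - v, hw⟩ := hKle.2 rfl
    exact ⟨⟨x - v, hwK⟩, e4.trans e3, rfl⟩
end
end

section
/- Let S be a densely defined, closed, symmetric operator in H with S ≥ ε I for some ε > 0, and λ ≠ 0. If v ∈ dom(S_K), v ≠ 0, satisfies S_K v = λ v, then u := (S_F)^{-1} S_K v satisfies u ∈ dom(S* S), u ≠ 0, and S* S u = λ S u. -/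
open Filter Topology

noncomputable section

variable {H : Type*} [NormedAddCommGroup H] [InnerProductSpace ℂ H] [CompleteSpace H]

local notation "⟪" x ", " y "⟫" => @inner ℂ _ _ x y

theorem aux_bound {S : H →ₗ.[ℂ] H} {ε : ℝ} (hS : StandingHyp S ε) (x : S.domain) :
    ε * ‖(x : H)‖ ≤ ‖(S x : H)‖ := by
  have h1 := hS.lower x
  have h2 : (⟪(x : H), (S x : H)⟫).re ≤ ‖(x : H)‖ * ‖(S x : H)‖ :=
    (Complex.re_le_norm _).trans (norm_inner_le_norm _ _)
  rcases (norm_nonneg (x : H)).eq_or_lt with h | h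
  · rw [← h]; simp
  · have : ‖(x : H)‖ * (ε * ‖(x : H)‖) ≤ ‖(x : H)‖ * ‖(S x : H)‖ := by nlinarith
    exact le_of_mul_le_mul_left this h

theorem aux_inj {S : H →ₗ.[ℂ] H} {ε : ℝ} (hS : StandingHyp S ε) (f : ℕ → S.domain) (h : H)
    (hf : Tendsto (fun j => ((f j : H))) atTop (nhds h))
    (hc : ∀ δ : ℝ, 0 < δ → ∃ N : ℕ, ∀ j ≥ N, ∀ k ≥ N,
      ‖⟪((f j - f k : S.domain) : H), (S (f j - f k) : H)⟫‖ < δ)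
    (h0 : ∀ x : S.domain, ⟪h, (S x : H)⟫ = 0) : h = 0 := by
  have key : ∀ δ : ℝ, 0 < δ → ε * ‖h‖ ^ 2 ≤ δ := by
    intro δ hδ
    obtain ⟨N, hN⟩ := hc δ hδ
    have hj : ∀ j ≥ N, ε * ‖(f j : H)‖ ^ 2 ≤ δ := by
      intro j hj
      have hlim : Tendsto (fun k => δ + 2 * (⟪(f k : H), (S (f j) : H)⟫).re) atTop
          (nhds (δ + 2 * (⟪h, (S (f j) : H)⟫).re)) := by
        apply Tendsto.const_add
        apply Tendsto.const_mul
        exact (Complex.continuous_re.tendsto _).comp (hf.inner tendsto_const_nhds)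
      rw [h0] at hlim
      simp only [Complex.zero_re, mul_zero, add_zero] at hlim
      refine ge_of_tendsto hlim ?_
      filter_upwards [eventually_ge_atTop N] with k hk
      have h1 := (Complex.re_le_norm _).trans (hN j hj k hk).le
      have h2 : (⟪(f j : H), (S (f k) : H)⟫).re = (⟪(f k : H), (S (f j) : H)⟫).re := by
        rw [← hS.symmetric, ← inner_conj_symm, Complex.conj_re]
      have h3 := hS.lower (f j)
      have h4 := hS.lower (f k)
      have h5 : 0 ≤ ε * ‖(f k : H)‖ ^ 2 := mul_nonneg hS.pos.le (sq_nonneg _)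
      rw [LinearPMap.map_sub, AddSubgroupClass.coe_sub, inner_sub_left, inner_sub_right,
        inner_sub_right] at h1
      simp only [Complex.sub_re] at h1
      linarith
    refine le_of_tendsto ((hf.norm.pow 2).const_mul ε) ?_
    filter_upwards [eventually_ge_atTop N] with j h using hj j h
  have h1 : ε * ‖h‖ ^ 2 ≤ 0 := le_of_forall_pos_le_add (fun δ hδ => by simpa using key δ hδ)
  have h2 : ‖h‖ ^ 2 ≤ 0 := by
    by_contra hh
    push Not at hh
    have := mul_pos hS.pos hh
    linarith
  have h3 : ‖h‖ = 0 := by nlinarith [norm_nonneg h]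
  exact norm_eq_zero.mp h3

/-- If `S_K v = λ v` with `v ≠ 0`, `λ ≠ 0`, then `u := (S_F)⁻¹ S_K v` satisfies
`u ∈ dom (S* S)`, `u ≠ 0` and `S* S u = λ S u`. -/
theorem krein_eigenvalue_to_buckling
    (S Sf Sk : H →ₗ.[ℂ] H) (ε : ℝ) (hS : StandingHyp S ε)
    (hF : IsFriedrichsExtension S Sf) (hK : IsKreinVonNeumannExtension S Sk)
    (lam : ℂ) (hlam : lam ≠ 0)
    (v : H) (hv : v ∈ Sk.domain) (hvne : v ≠ 0) (heig : Sk ⟨v, hv⟩ = lam • v)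
    (u : H) (hu : u ∈ Sf.domain) (hFu : Sf ⟨u, hu⟩ = Sk ⟨v, hv⟩) :
    u ≠ 0 ∧ ∃ huS : u ∈ S.domain, ∃ hSu : (S ⟨u, huS⟩ : H) ∈ S.adjoint.domain,
      S.adjoint ⟨S ⟨u, huS⟩, hSu⟩ = lam • (S ⟨u, huS⟩ : H) := by
  have adj := LinearPMap.adjoint_isFormalAdjoint hS.dense
  -- range of `S` is closed
  obtain ⟨hva, g, hg, -⟩ := (hK.2 v).1 hv
  have hSkv : Sk ⟨v, hv⟩ = S.adjoint ⟨v, hva⟩ := hK.1.2 rfl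
  have hgc : CauchySeq (fun j => ((g j : H))) := by
    rw [Metric.cauchySeq_iff]
    intro δ hδ
    obtain ⟨N, hN⟩ := Metric.cauchySeq_iff.1 hg.cauchySeq (ε * δ) (mul_pos hS.pos hδ)
    refine ⟨N, fun j hj k hk => ?_⟩
    have h1 := hN j hj k hk
    have h2 := aux_bound hS (g j - g k)
    rw [LinearPMap.map_sub, AddSubgroupClass.coe_sub] at h2
    rw [dist_eq_norm] at h1 ⊢
    exact lt_of_mul_lt_mul_left (h2.trans_lt h1) hS.pos.le
  obtain ⟨w, hw⟩ := cauchySeq_tendsto_of_complete hgc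
  have hgr : (w, S.adjoint ⟨v, hva⟩) ∈ (S.graph : Set (H × H)) :=
    IsClosed.mem_of_tendsto hS.closed (hw.prodMk_nhds hg)
      (Eventually.of_forall fun j => S.mem_graph (g j))
  obtain ⟨w', hw1, hw2⟩ := (LinearPMap.mem_graph_iff S).1 hgr
  simp only at hw1 hw2
  obtain ⟨hua, f, hf, hfc⟩ := (hF.2 u).1 hu
  have hSfu : Sf ⟨u, hu⟩ = S.adjoint ⟨u, hua⟩ := hF.1.2 rfl
  have huw : u - w = 0 := by
    refine aux_inj hS (fun j => f j - w') (u - w) ?_ ?_ ?_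
    · simpa [hw1] using hf.sub_const w
    · simpa using hfc
    · intro x
      rw [inner_sub_left, ← hw1, ← hS.symmetric, hw2, ← hSkv, ← hFu, hSfu, sub_eq_zero]
      exact (adj ⟨u, hua⟩ x).symm
  have huw2 : u = w' := by rw [hw1]; exact sub_eq_zero.1 huw
  subst huw2
  have hSw : S w' = lam • v := by rw [hw2, ← hSkv, heig]
  refine ⟨?_, w'.2, ?_⟩
  · intro h
    have : w' = 0 := Subtype.ext h
    rw [this, LinearPMap.map_zero] at hSw
    exact (smul_ne_zero hlam hvne) hSw.symm
  · have hmem : S w' ∈ S.adjoint.domain := by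
      rw [hSw]; exact S.adjoint.domain.smul_mem _ hva
    refine ⟨hmem, ?_⟩
    have e : (⟨S w', hmem⟩ : S.adjoint.domain) = lam • ⟨v, hva⟩ := Subtype.ext hSw
    change S.adjoint ⟨S w', hmem⟩ = lam • S w'
    rw [e, LinearPMap.map_smul, hw2]
end
end

section
/- Let S be a densely defined, closed, symmetric operator in H with S ≥ ε I for some ε > 0, and λ ≠ 0. If u ∈ dom(S* S), u ≠ 0, satisfies S* S u = λ S u, then v := λ^{-1} S u satisfies v ∈ dom(S_K), v ≠ 0, and S_K v = λ v. -/
open Filter Topology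

noncomputable section

variable {H : Type*} [NormedAddCommGroup H] [InnerProductSpace ℂ H] [CompleteSpace H]

local notation "⟪" x ", " y "⟫" => @inner ℂ _ _ x y

/-- If `S* S u = λ S u` with `u ≠ 0`, `λ ≠ 0`, then `v := λ⁻¹ S u` satisfies
`v ∈ dom S_K`, `v ≠ 0` and `S_K v = λ v`. -/
theorem buckling_to_krein_eigenvalue
    (S Sk : H →ₗ.[ℂ] H) (ε : ℝ) (hS : StandingHyp S ε)
    (hK : IsKreinVonNeumannExtension S Sk)
    (lam : ℂ) (hlam : lam ≠ 0)
    (u : H) (hu : u ∈ S.domain) (hune : u ≠ 0)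
    (hSu : (S ⟨u, hu⟩ : H) ∈ S.adjoint.domain)
    (heig : S.adjoint ⟨S ⟨u, hu⟩, hSu⟩ = lam • (S ⟨u, hu⟩ : H)) :
    lam⁻¹ • (S ⟨u, hu⟩ : H) ≠ 0 ∧
    ∃ hv : lam⁻¹ • (S ⟨u, hu⟩ : H) ∈ Sk.domain,
      Sk ⟨lam⁻¹ • (S ⟨u, hu⟩ : H), hv⟩ = lam • (lam⁻¹ • (S ⟨u, hu⟩ : H)) := by
  have hne : (S ⟨u, hu⟩ : H) ≠ 0 := by
    intro h0
    have h := hS.lower ⟨u, hu⟩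
    rw [h0, inner_zero_right] at h
    have h1 : 0 < ‖u‖ := norm_pos_iff.mpr hune
    have h2 : 0 < ε * ‖u‖ ^ 2 := mul_pos hS.pos (pow_pos h1 2)
    simp only [Complex.zero_re] at h
    linarith
  have hv' : lam⁻¹ • (S ⟨u, hu⟩ : H) ∈ S.adjoint.domain := Submodule.smul_mem _ _ hSu
  have hval : S.adjoint ⟨lam⁻¹ • (S ⟨u, hu⟩ : H), hv'⟩ = S ⟨u, hu⟩ := by
    have h := S.adjoint.map_smul lam⁻¹ ⟨S ⟨u, hu⟩, hSu⟩
    rw [heig, inv_smul_smul₀ hlam] at h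
    exact h
  have hv : lam⁻¹ • (S ⟨u, hu⟩ : H) ∈ Sk.domain := by
    rw [hK.2]
    refine ⟨hv', fun _ => ⟨u, hu⟩, ?_, ?_⟩
    · rw [hval]
      exact tendsto_const_nhds
    · intro δ hδ
      refine ⟨0, fun j _ k _ => ?_⟩
      simpa using hδ
  refine ⟨smul_ne_zero (inv_ne_zero hlam) hne, hv, ?_⟩
  rw [smul_inv_smul₀ hlam]
  refine Eq.trans ?_ hval
  exact hK.1.2 rfl
end
end

section
/- Let S be a densely defined, closed operator in H with ‖Su‖ ≥ ε‖u‖ for all u ∈ dom(S) (ε > 0), and let W be the Hilbert space dom(S) equipped with the inner product (u,v)_W = (Su, Sv)_H. Then the sesquilinear form b(u,v) = (u, Sv)_H on W defines a unique operator T ∈ B(W) via (w₁, T w₂)_W = (w₁, S w₂)_H, and T satisfies 0 ≤ T = T* and ‖T‖_{B(W)} ≤ ε^{-1}. -/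
open Filter Topology

noncomputable section

variable {H : Type*} [NormedAddCommGroup H] [InnerProductSpace ℂ H] [CompleteSpace H]

local notation "⟪" x ", " y "⟫" => @inner ℂ _ _ x y

lemma aux_lower {S : H →ₗ.[ℂ] H} {ε : ℝ} (hS : StandingHyp S ε) (u : S.domain) :
    ‖(u : H)‖ ≤ ε⁻¹ * ‖(S u : H)‖ := by
  have h1 := hS.lower u
  have h2 : (⟪(u : H), (S u : H)⟫).re ≤ ‖(u : H)‖ * ‖(S u : H)‖ :=
    (Complex.re_le_norm _).trans (norm_inner_le_norm _ _)
  have hp := hS.pos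
  rw [inv_mul_eq_div, le_div_iff₀ hp]
  rcases (norm_nonneg (u : H)).eq_or_lt with h | h
  · rw [← h]; simp
  · have : ‖(u : H)‖ * (‖(u : H)‖ * ε) ≤ ‖(u : H)‖ * ‖(S u : H)‖ := by nlinarith
    exact le_of_mul_le_mul_left this h

lemma aux_closed {S : H →ₗ.[ℂ] H} {ε : ℝ} (hS : StandingHyp S ε) :
    IsClosed (LinearMap.range S.toFun : Set H) := by
  have hc : CompleteSpace S.graph := (show IsClosed (S.graph : Set (H × H)) from hS.closed).completeSpace_coe
  let f : S.graph →L[ℂ] H := (ContinuousLinearMap.snd ℂ H H).comp S.graph.subtypeL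
  have hf : AntilipschitzWith (max ε⁻¹ 1).toNNReal f := by
    apply AddMonoidHomClass.antilipschitz_of_bound
    rintro ⟨⟨a, b⟩, hx⟩
    obtain ⟨u, rfl, rfl⟩ := (LinearPMap.mem_graph_iff _).1 hx
    have h1 := aux_lower hS u
    rw [Real.coe_toNNReal _ (le_max_of_le_right zero_le_one)]
    change max ‖(u : H)‖ ‖(S u : H)‖ ≤ max ε⁻¹ 1 * ‖(S u : H)‖
    apply max_le
    · exact h1.trans (mul_le_mul_of_nonneg_right (le_max_left _ _) (norm_nonneg _))
    · exact le_mul_of_one_le_left (norm_nonneg _) (le_max_right _ _)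
  have := hf.isClosed_range f.uniformContinuous
  convert this using 1
  ext y
  constructor
  · rintro ⟨u, rfl⟩
    exact ⟨⟨_, S.mem_graph u⟩, rfl⟩
  · rintro ⟨⟨⟨a, b⟩, hx⟩, rfl⟩
    obtain ⟨u, rfl, rfl⟩ := (LinearPMap.mem_graph_iff _).1 hx
    exact ⟨u, rfl⟩

/-- The abstract buckling problem operator `T` on the Hilbert space
`W = (dom S, ⟪S·, S·⟫)`: the form `b(u,v) = ⟪u, S v⟫` defines a unique operator `T`
via `(w₁, T w₂)_W = ⟪w₁, S w₂⟫`, which is nonnegative, self-adjoint (in `W`), and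
bounded with `‖T‖ ≤ ε⁻¹`. -/
theorem abstract_buckling_operator_exists
    (S : H →ₗ.[ℂ] H) (ε : ℝ) (hS : StandingHyp S ε) :
    ∃ T : S.domain →ₗ[ℂ] S.domain,
      (∀ w₁ w₂ : S.domain, ⟪(S w₁ : H), (S (T w₂) : H)⟫ = ⟪(w₁ : H), (S w₂ : H)⟫) ∧
      (∀ T' : S.domain →ₗ[ℂ] S.domain,
        (∀ w₁ w₂ : S.domain, ⟪(S w₁ : H), (S (T' w₂) : H)⟫ = ⟪(w₁ : H), (S w₂ : H)⟫) →
        T' = T) ∧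
      (∀ w₁ w₂ : S.domain, ⟪(S (T w₁) : H), (S w₂ : H)⟫ = ⟪(S w₁ : H), (S (T w₂) : H)⟫) ∧
      (∀ w : S.domain, 0 ≤ (⟪(S w : H), (S (T w) : H)⟫).re) ∧
      (∀ w : S.domain, ‖(S (T w) : H)‖ ≤ ε⁻¹ * ‖(S w : H)‖) := by
  have hlow := aux_lower hS
  have hinj : Function.Injective S.toFun := by
    rw [← LinearMap.ker_eq_bot, LinearMap.ker_eq_bot']
    intro u hu
    have h := hlow u
    rw [show S u = 0 from hu, norm_zero, mul_zero] at h
    exact Subtype.ext (norm_le_zero_iff.1 h)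
  have hcl := aux_closed hS
  haveI : CompleteSpace (LinearMap.range S.toFun) := hcl.completeSpace_coe
  let e := LinearEquiv.ofInjective S.toFun hinj
  have he : ∀ y, S (e.symm y) = (y : H) := fun y =>
    congrArg Subtype.val (e.apply_symm_apply y)
  let R : LinearMap.range S.toFun →L[ℂ] H :=
    (S.domain.subtype ∘ₗ e.symm.toLinearMap).mkContinuous ε⁻¹ (by
      intro y
      have h := hlow (e.symm y)
      rw [he] at h
      exact h)
  let T : S.domain →ₗ[ℂ] S.domain :=
    e.symm.toLinearMap ∘ₗ (ContinuousLinearMap.adjoint R).toLinearMap ∘ₗ S.toFun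
  have hT : ∀ w₁ w₂ : S.domain, ⟪(S w₁ : H), (S (T w₂) : H)⟫ = ⟪(w₁ : H), (S w₂ : H)⟫ := by
    intro w₁ w₂
    have h1 : S (T w₂) = ((ContinuousLinearMap.adjoint R (S w₂) : LinearMap.range S.toFun) : H) :=
      he _
    have h2 := ContinuousLinearMap.adjoint_inner_right R (e w₁) (S w₂)
    have h3 : R (e w₁) = (w₁ : H) := congrArg Subtype.val (e.symm_apply_apply w₁)
    rw [h3] at h2
    rw [h1]
    exact h2
  refine ⟨T, hT, ?_, ?_, ?_, ?_⟩
  · intro T' hT'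
    ext1 w
    apply hinj
    change S (T' w) = S (T w)
    rw [← sub_eq_zero, ← S.map_sub, ← inner_self_eq_zero (𝕜 := ℂ)]
    nth_rewrite 2 [S.map_sub]
    rw [inner_sub_right, hT, hT', sub_self]
  · intro w₁ w₂
    rw [hT, ← inner_conj_symm, hT, inner_conj_symm, hS.symmetric]
  · intro w
    rw [hT]
    exact le_trans (mul_nonneg hS.pos.le (sq_nonneg _)) (hS.lower w)
  · intro w
    have h1 : ‖(S (T w) : H)‖ * ‖(S (T w) : H)‖ ≤ ‖(S (T w) : H)‖ * (ε⁻¹ * ‖(S w : H)‖) := by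
      calc _ = ‖⟪(S (T w) : H), (S (T w) : H)⟫‖ := by
            rw [inner_self_eq_norm_sq_to_K, norm_pow]; simp [sq]
        _ = ‖⟪(T w : H), (S w : H)⟫‖ := by rw [hT]
        _ ≤ ‖(T w : H)‖ * ‖(S w : H)‖ := norm_inner_le_norm _ _
        _ ≤ (ε⁻¹ * ‖(S (T w) : H)‖) * ‖(S w : H)‖ :=
            mul_le_mul_of_nonneg_right (hlow _) (norm_nonneg _)
        _ = _ := by ring
    rcases (norm_nonneg (S (T w) : H)).eq_or_lt with h | h
    · rw [← h]; exact mul_nonneg (inv_nonneg.2 hS.pos.le) (norm_nonneg _)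
    · exact le_of_mul_le_mul_left h1 h
end
end

section
/- Let S be a densely defined, closed, symmetric operator in H with S ≥ ε I (ε > 0), Q = I - P_{ker(S*)}, and let u ∈ dom(S). Then Qu ∈ dom(S_K) and S_K(Qu) = Q(S_K u) = Q(Su) = Su; in particular Su ∈ (ker S*)^⊥. -/
open Filter Topology

noncomputable section

variable {H : Type*} [NormedAddCommGroup H] [InnerProductSpace ℂ H] [CompleteSpace H]

local notation "⟪" x ", " y "⟫" => @inner ℂ _ _ x y

/-- For `u ∈ dom S` and `q = (I - P_{ker S*}) u`: `q ∈ dom S_K`,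
`S_K q = S u = S_K u = (I - P_{ker S*}) S_K u`, and `S u ∈ (ker S*)ᗮ`. -/
theorem krein_commutes_with_projection
    (S Sk : H →ₗ.[ℂ] H) (ε : ℝ) (hS : StandingHyp S ε)
    (hK : IsKreinVonNeumannExtension S Sk)
    (u : H) (hu : u ∈ S.domain) (q : H) (hq : IsOrthProjOn (pKer S.adjoint) u q) :
    (∃ hq' : q ∈ Sk.domain, Sk ⟨q, hq'⟩ = (S ⟨u, hu⟩ : H)) ∧
    (∃ hu' : u ∈ Sk.domain, Sk ⟨u, hu'⟩ = (S ⟨u, hu⟩ : H)) ∧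
    (S ⟨u, hu⟩ : H) ∈ (pKer S.adjoint)ᗮ := by
  have hran : ∀ x : S.domain, (S x : H) ∈ (pKer S.adjoint)ᗮ := by
    intro x
    rw [Submodule.mem_orthogonal]
    rintro w ⟨y, hy, rfl⟩
    have h1 := LinearPMap.adjoint_isFormalAdjoint hS.dense y x
    have h2 : S.adjoint y = 0 := hy
    rw [h2, inner_zero_left] at h1
    exact h1.symm
  have key : ∀ v : H, (∀ x : S.domain, ⟪(S ⟨u, hu⟩ : H), (x : H)⟫ = ⟪v, (S x : H)⟫) →
      ∃ hv : v ∈ Sk.domain, Sk ⟨v, hv⟩ = (S ⟨u, hu⟩ : H) := by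
    intro v hv
    have hd : v ∈ S.adjoint.domain := LinearPMap.mem_adjoint_domain_of_exists v ⟨_, hv⟩
    have he : S.adjoint ⟨v, hd⟩ = S ⟨u, hu⟩ :=
      LinearPMap.adjoint_apply_eq hS.dense ⟨v, hd⟩ hv
    have hm : v ∈ Sk.domain := by
      refine (hK.2 v).2 ⟨hd, fun _ => ⟨u, hu⟩, ?_, ?_⟩
      · rw [he]
        exact tendsto_const_nhds
      · intro δ hδ
        refine ⟨0, fun j _ k _ => ?_⟩
        simpa using hδ
    refine ⟨hm, ?_⟩
    rw [← he]
    exact hK.1.2 rfl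
  refine ⟨key q ?_, key u ?_, hran _⟩
  · intro x
    have h := (Submodule.mem_orthogonal' _ _).1 hq.2 _ (hran x)
    rw [inner_sub_left, sub_eq_zero] at h
    rw [← h]
    exact hS.symmetric ⟨u, hu⟩ x
  · intro x
    exact hS.symmetric ⟨u, hu⟩ x
end
end

section
/- Let S be a densely defined, closed, symmetric operator in H with S ≥ ε I (ε > 0). Then the inverse of the reduced Krein–von Neumann operator Ŝ_K on Ĥ = (ker S*)^⊥ and the abstract buckling operator T on W are unitarily equivalent: (Ŝ_K)^{-1} = Ŝ T Ŝ^{-1}, where Ŝ : W → Ĥ, w ↦ Sw, is unitary. -/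
open Filter Topology

noncomputable section

variable {H : Type*} [NormedAddCommGroup H] [InnerProductSpace ℂ H] [CompleteSpace H]

local notation "⟪" x ", " y "⟫" => @inner ℂ _ _ x y

/-- Unitary equivalence `(Ŝ_K)⁻¹ = Ŝ T Ŝ⁻¹`: if `T` is the abstract buckling operator,
defined by `(w₁, T w₂)_W = ⟪w₁, S w₂⟫`, then for every `w ∈ W = dom S` one has
`S (T w) ∈ dom S_K ∩ (ker S*)ᗮ` and `S_K (S (T w)) = S w`. -/
theorem reduced_krein_inverse_unitarily_equivalent_buckling
    (S Sk : H →ₗ.[ℂ] H) (ε : ℝ) (hS : StandingHyp S ε)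
    (hK : IsKreinVonNeumannExtension S Sk)
    (T : S.domain →ₗ[ℂ] S.domain)
    (hT : ∀ w₁ w₂ : S.domain, ⟪(S w₁ : H), (S (T w₂) : H)⟫ = ⟪(w₁ : H), (S w₂ : H)⟫)
    (w : S.domain) :
    ∃ h : (S (T w) : H) ∈ Sk.domain,
      (S (T w) : H) ∈ (pKer S.adjoint)ᗮ ∧ Sk ⟨(S (T w) : H), h⟩ = (S w : H) := by
  have key : ∀ x : S.domain, ⟪(S w : H), (x : H)⟫ = ⟪(S (T w) : H), (S x : H)⟫ := by
    intro x
    rw [← inner_conj_symm, ← hT x w, inner_conj_symm]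
  have hv : (S (T w) : H) ∈ S.adjoint.domain :=
    LinearPMap.mem_adjoint_domain_of_exists _ ⟨_, key⟩
  have hval : S.adjoint ⟨(S (T w) : H), hv⟩ = (S w : H) :=
    LinearPMap.adjoint_apply_eq hS.dense _ key
  have h : (S (T w) : H) ∈ Sk.domain := by
    refine (hK.2 _).2 ⟨hv, fun _ => w, ?_, ?_⟩
    · rw [hval]
      exact tendsto_const_nhds
    · intro δ hδ
      refine ⟨0, fun j _ k _ => ?_⟩
      simpa using hδ
  refine ⟨h, ?_, ?_⟩
  · rw [Submodule.mem_orthogonal]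
    rintro u ⟨y, hy, rfl⟩
    have h1 := LinearPMap.adjoint_isFormalAdjoint hS.dense y (T w)
    have h2 : S.adjoint y = 0 := hy
    rw [h2, inner_zero_left] at h1
    exact h1.symm
  · rw [← hval]
    exact hK.1.2 rfl
end
end

section
/- Let S be a densely defined, closed, symmetric operator in H with S ≥ ε I (ε > 0), with polar decomposition S = U_S |S|, |S| = (S*S)^{1/2} ≥ ε I, U_S : H → Ĥ unitary. Then the operator |S|^{-1} S |S|^{-1} extends to a bounded self-adjoint operator on H, and (Ŝ_K)^{-1} = U_S [|S|^{-1} S |S|^{-1}] (U_S)^{-1} on Ĥ. -/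
open Filter Topology

noncomputable section

variable {H : Type*} [NormedAddCommGroup H] [InnerProductSpace ℂ H] [CompleteSpace H]

local notation "⟪" x ", " y "⟫" => @inner ℂ _ _ x y

/-- `(Ŝ_K)⁻¹ = U_S [|S|⁻¹ S |S|⁻¹] (U_S)⁻¹`: given the polar decomposition `S = U_S |S|`,
the operator `|S|⁻¹ S |S|⁻¹` extends to a bounded self-adjoint operator `C` on `H`
(characterized by `C (|S| u) = |S|⁻¹ (S u)` for `u ∈ dom S`), and for every `x ∈ H`,
`U_S (C x)` lies in `dom S_K ∩ (ker S*)ᗮ` with `S_K (U_S (C x)) = U_S x`. -/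
theorem reduced_krein_inverse_polar_formula
    (S Sk : H →ₗ.[ℂ] H) (ε : ℝ) (hS : StandingHyp S ε)
    (hK : IsKreinVonNeumannExtension S Sk)
    -- B = |S| = (S* S)^{1/2}: nonnegative self-adjoint, dom B = dom S,
    -- and ⟪B u, B v⟫ = ⟪S u, S v⟫.
    (B : H →ₗ.[ℂ] H) (hBdom : B.domain = S.domain)
    (hBsa : B.adjoint = B)
    (hBnn : ∀ u : B.domain, 0 ≤ (⟪(u : H), (B u : H)⟫).re)
    (hBsq : ∀ (x y : H) (hxB : x ∈ B.domain) (hxS : x ∈ S.domain)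
      (hyB : y ∈ B.domain) (hyS : y ∈ S.domain),
      ⟪(B ⟨x, hxB⟩ : H), (B ⟨y, hyB⟩ : H)⟫ = ⟪(S ⟨x, hxS⟩ : H), (S ⟨y, hyS⟩ : H)⟫)
    -- U_S : H → Ĥ unitary with U_S (B u) = S u.
    (U : H →ₗᵢ[ℂ] H) (hUrange : Set.range U = ((pKer S.adjoint)ᗮ : Set H))
    (hU : ∀ (x : H) (hxB : x ∈ B.domain) (hxS : x ∈ S.domain),
      U (B ⟨x, hxB⟩) = S ⟨x, hxS⟩) :
    ∃ C : H →L[ℂ] H, IsSelfAdjoint C ∧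
      (∀ (u z : H) (huB : u ∈ B.domain) (huS : u ∈ S.domain) (hzB : z ∈ B.domain),
        (B ⟨z, hzB⟩ : H) = S ⟨u, huS⟩ → C (B ⟨u, huB⟩) = z) ∧
      (∀ x : H, ∃ h : U (C x) ∈ Sk.domain,
        U (C x) ∈ (pKer S.adjoint)ᗮ ∧ Sk ⟨U (C x), h⟩ = U x) := by
  classical
  have hBd : Dense (B.domain : Set H) := by rw [hBdom]; exact hS.dense
  have hsym : ∀ u v : B.domain, ⟪(B u : H), (v : H)⟫ = ⟪(u : H), (B v : H)⟫ := by
    intro u v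
    have h := LinearPMap.adjoint_isFormalAdjoint hBd
    rw [hBsa] at h
    exact h u v
  have hmem : ∀ u y : H, (∀ v : B.domain, ⟪y, (v : H)⟫ = ⟪u, (B v : H)⟫) →
      ∃ h : u ∈ B.domain, B ⟨u, h⟩ = y := by
    intro u y h
    have h1 : u ∈ B.adjoint.domain := LinearPMap.mem_adjoint_domain_of_exists u ⟨y, h⟩
    have h2 : B.adjoint ⟨u, h1⟩ = y := LinearPMap.adjoint_apply_eq hBd ⟨u, h1⟩ h
    rw [← hBsa]
    exact ⟨h1, h2⟩
  have hlow : ∀ u : B.domain, ε * ‖(u : H)‖ ≤ ‖(B u : H)‖ := by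
    rintro ⟨u, hu⟩
    have hu' : u ∈ S.domain := hBdom ▸ hu
    have h1 := hS.lower ⟨u, hu'⟩
    have h2 : ‖(B ⟨u, hu⟩ : H)‖ = ‖(S ⟨u, hu'⟩ : H)‖ := by
      rw [← hU u hu hu', U.norm_map]
    have h3 : (⟪u, (S ⟨u, hu'⟩ : H)⟫).re ≤ ‖u‖ * ‖(S ⟨u, hu'⟩ : H)‖ :=
      re_inner_le_norm (𝕜 := ℂ) u _
    rw [h2]
    simp only at h1 ⊢
    rcases eq_or_lt_of_le (norm_nonneg u) with h0 | h0
    · rw [← h0]; simp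
    · nlinarith
  have hinj : Function.Injective B.toFun := by
    rw [injective_iff_map_eq_zero]
    intro u hu
    have h := hlow u
    change B u = 0 at hu
    rw [hu, norm_zero] at h
    have hp := hS.pos
    have : ‖(u : H)‖ = 0 := by nlinarith [norm_nonneg (u : H)]
    exact Subtype.ext (norm_eq_zero.mp this)
  have hclosed : IsClosed (LinearMap.range B.toFun : Set H) := by
    apply IsSeqClosed.isClosed
    intro y y0 hy hlim
    choose u hu using hy
    have hc : CauchySeq (fun n => (u n : H)) := by
      have hyc := hlim.cauchySeq
      rw [Metric.cauchySeq_iff] at hyc ⊢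
      intro δ hδ
      obtain ⟨N, hN⟩ := hyc (ε * δ) (mul_pos hS.pos hδ)
      refine ⟨N, fun m hm n hn => ?_⟩
      have h1 := hN m hm n hn
      have h2 := hlow (u m - u n)
      have h3 : (B (u m - u n) : H) = y m - y n := by
        rw [← hu m, ← hu n]; exact map_sub B.toFun _ _
      rw [h3, ← dist_eq_norm, Submodule.coe_sub, ← dist_eq_norm] at h2
      exact lt_of_mul_lt_mul_left (h2.trans_lt h1) hS.pos.le
    obtain ⟨u0, hu0⟩ := cauchySeq_tendsto_of_complete hc
    obtain ⟨h, h'⟩ := hmem u0 y0 (fun v => by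
      have a1 : Tendsto (fun n => ⟪y n, (v : H)⟫) atTop (𝓝 ⟪y0, (v : H)⟫) :=
        hlim.inner tendsto_const_nhds
      have a2 : Tendsto (fun n => ⟪(u n : H), (B v : H)⟫) atTop (𝓝 ⟪u0, (B v : H)⟫) :=
        hu0.inner tendsto_const_nhds
      refine tendsto_nhds_unique a1 (a2.congr fun n => ?_)
      rw [← hsym, ← hu n]; rfl)
    exact ⟨⟨u0, h⟩, h'⟩
  have hsurj : Function.Surjective B.toFun := by
    rw [← LinearMap.range_eq_top]
    have : CompleteSpace (LinearMap.range B.toFun) := hclosed.completeSpace_coe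
    rw [← Submodule.orthogonal_eq_bot_iff, Submodule.eq_bot_iff]
    intro w hw
    rw [Submodule.mem_orthogonal'] at hw
    obtain ⟨h, h'⟩ := hmem w 0 (fun v => by
      rw [inner_zero_left]; exact (hw _ ⟨v, rfl⟩).symm)
    have h0 : (⟨w, h⟩ : B.domain) = 0 := hinj (by rw [map_zero]; exact h')
    exact congrArg Subtype.val h0
  let e := LinearEquiv.ofBijective B.toFun ⟨hinj, hsurj⟩
  have he : ∀ y, B (e.symm y) = y := fun y => e.apply_symm_apply y
  have he' : ∀ u, e.symm (B u) = u := fun u => e.symm_apply_apply u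
  let T : H →L[ℂ] H := LinearMap.mkContinuous (B.domain.subtype ∘ₗ e.symm.toLinearMap) ε⁻¹ (by
    intro y
    have h := hlow (e.symm y)
    rw [he] at h
    rw [inv_mul_eq_div, le_div_iff₀ hS.pos, mul_comm]
    exact h)
  have hT : ∀ y, T y = (e.symm y : H) := fun y => rfl
  have hTsym : ∀ x y, ⟪T x, y⟫ = ⟪x, T y⟫ := by
    intro x y
    have h := hsym (e.symm x) (e.symm y)
    rw [he, he] at h
    exact h.symm
  have hdS : ∀ x, (e.symm x : H) ∈ S.domain := fun x => hBdom ▸ (e.symm x).2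
  have hUS : ∀ x, U x = S ⟨e.symm x, hdS x⟩ := by
    intro x
    rw [← hU _ (e.symm x).2]
    exact congrArg U (he x).symm
  refine ⟨T ∘L U.toContinuousLinearMap, ?_, ?_, ?_⟩
  · rw [ContinuousLinearMap.isSelfAdjoint_iff_isSymmetric]
    intro x y
    change ⟪T (U x), y⟫ = ⟪x, T (U y)⟫
    rw [hTsym, ← hTsym x, hUS, hUS, hT, hT]
    exact hS.symmetric ⟨_, hdS x⟩ ⟨_, hdS y⟩
  · intro u z huB huS hzB h
    change T (U (B ⟨u, huB⟩)) = z
    rw [hU u huB huS, ← h, hT, he']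
  · intro x
    change ∃ h : U (T (U x)) ∈ Sk.domain, U (T (U x)) ∈ (pKer S.adjoint)ᗮ ∧ Sk ⟨U (T (U x)), h⟩ = U x
    have hf : ∀ v : S.domain, ⟪U x, (v : H)⟫ = ⟪U (T (U x)), (S v : H)⟫ := by
      rintro ⟨v, hv⟩
      have hvB : v ∈ B.domain := hBdom ▸ hv
      rw [← hU v hvB hv, U.inner_map_map, hTsym, hT, he']
    have hd : U (T (U x)) ∈ S.adjoint.domain :=
      LinearPMap.mem_adjoint_domain_of_exists _ ⟨U x, hf⟩
    have hv : S.adjoint ⟨_, hd⟩ = U x := LinearPMap.adjoint_apply_eq hS.dense ⟨_, hd⟩ hf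
    have hk : U (T (U x)) ∈ Sk.domain := by
      rw [hK.2]
      refine ⟨hd, fun _ => ⟨e.symm x, hdS x⟩, ?_, ?_⟩
      · rw [hv, hUS]; exact tendsto_const_nhds
      · intro δ hδ
        refine ⟨0, fun j _ k _ => ?_⟩
        simpa using hδ
    refine ⟨hk, ?_, ?_⟩
    · have : U (T (U x)) ∈ Set.range U := ⟨_, rfl⟩
      rw [hUrange] at this
      exact this
    · exact Eq.trans (hK.1.2 rfl) hv
end
end

section
/- Let S be a densely defined, closed, symmetric operator in H with S ≥ ε I (ε > 0) and polar decomposition S = U_S|S|. Then for λ ≠ 0, u ∈ dom(S*S) satisfies S*S u = λ S u if and only if w = |S| u satisfies |S|^{-1} S |S|^{-1} w = λ^{-1} w. -/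
open Filter Topology

noncomputable section

variable {H : Type*} [NormedAddCommGroup H] [InnerProductSpace ℂ H] [CompleteSpace H]

local notation "⟪" x ", " y "⟫" => @inner ℂ _ _ x y

theorem aux_graph (B : H →ₗ.[ℂ] H) (hd : Dense (B.domain : Set H)) (hBsa : B.adjoint = B)
    (x y : H) (h : ∀ v : B.domain, ⟪y, (v : H)⟫ = ⟪x, (B v : H)⟫) :
    ∃ hx : x ∈ B.domain, B ⟨x, hx⟩ = y := by
  have key : ∃ hx : x ∈ B.adjoint.domain, B.adjoint ⟨x, hx⟩ = y :=
    ⟨LinearPMap.mem_adjoint_domain_of_exists x ⟨y, h⟩, LinearPMap.adjoint_apply_eq hd _ h⟩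
  rw [hBsa] at key
  exact key

theorem aux_surj (B : H →ₗ.[ℂ] H) (hd : Dense (B.domain : Set H)) (hBsa : B.adjoint = B)
    (ε : ℝ) (hε : 0 < ε) (hb : ∀ x : B.domain, ε * ‖(x : H)‖ ≤ ‖B x‖) (y : H) :
    ∃ z : B.domain, B z = y := by
  have hcl : _root_.IsClosed (B.graph : Set (H × H)) := by
    have h := LinearPMap.adjoint_isClosed hd
    rw [hBsa] at h
    exact h
  haveI : CompleteSpace B.graph := hcl.completeSpace_coe
  let f : B.graph →L[ℂ] H := (ContinuousLinearMap.snd ℂ H H).comp B.graph.subtypeL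
  have hanti : AntilipschitzWith (Real.toNNReal (max 1 ε⁻¹)) f := by
    apply AddMonoidHomClass.antilipschitz_of_bound
    rintro ⟨⟨a, b⟩, hp⟩
    obtain ⟨z, hz1, hz2⟩ := (LinearPMap.mem_graph_iff B).1 hp
    have hz := hb z
    simp only at hz1 hz2
    rw [hz1, hz2] at hz
    change ‖(a, b)‖ ≤ _ * ‖b‖
    rw [Real.coe_toNNReal _ (le_trans zero_le_one (le_max_left _ _)), Prod.norm_def]
    apply max_le
    · calc ‖a‖ ≤ ε⁻¹ * ‖b‖ := by
            rw [inv_mul_eq_div, le_div_iff₀ hε]; linarith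
        _ ≤ _ := by gcongr; exact le_max_right _ _
    · calc ‖b‖ = 1 * ‖b‖ := by ring
        _ ≤ _ := by gcongr; exact le_max_left _ _
  have hr : _root_.IsClosed (Set.range f) := hanti.isClosed_range f.uniformContinuous
  let K : Submodule ℂ H := LinearMap.range f.toLinearMap
  have hK : _root_.IsClosed (K : Set H) := by
    have : (K : Set H) = Set.range f := by ext; simp [K]
    rw [this]; exact hr
  haveI : CompleteSpace K := hK.completeSpace_coe
  have hbot : Kᗮ = ⊥ := by
    rw [Submodule.eq_bot_iff]
    intro x hx
    obtain ⟨hxd, hx0⟩ := aux_graph B hd hBsa x 0 (fun v => by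
      rw [inner_zero_left]
      symm
      apply Submodule.inner_left_of_mem_orthogonal (K := K) _ hx
      exact ⟨⟨((v : H), B v), B.mem_graph v⟩, rfl⟩)
    have h := hb ⟨x, hxd⟩
    rw [hx0, norm_zero] at h
    have : ‖x‖ ≤ 0 := by
      by_contra hc
      push Not at hc
      have := mul_pos hε hc
      simp only at h
      linarith
    simpa using this
  have htop : K = ⊤ := Submodule.orthogonal_eq_bot_iff.1 hbot
  have hy : y ∈ K := htop ▸ Submodule.mem_top
  obtain ⟨⟨p, hp⟩, hpy⟩ := hy
  obtain ⟨z, -, hz2⟩ := (LinearPMap.mem_graph_iff B).1 hp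
  exact ⟨z, hz2.trans hpy⟩

/-- The abstract buckling pencil problem as a standard eigenvalue problem:
`S* S u = λ S u` iff `|S|⁻¹ S |S|⁻¹ w = λ⁻¹ w` for `w = |S| u`, where `C` is the bounded
self-adjoint operator `|S|⁻¹ S |S|⁻¹` (characterized by `C (|S| z) = z'` whenever
`|S| z' = S z`). -/
theorem buckling_pencil_standard_eigenvalue
    (S : H →ₗ.[ℂ] H) (ε : ℝ) (hS : StandingHyp S ε)
    (B : H →ₗ.[ℂ] H) (hBdom : B.domain = S.domain)
    (hBsa : B.adjoint = B)
    (hBnn : ∀ u : B.domain, 0 ≤ (⟪(u : H), (B u : H)⟫).re)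
    (hBsq : ∀ (x y : H) (hxB : x ∈ B.domain) (hxS : x ∈ S.domain)
      (hyB : y ∈ B.domain) (hyS : y ∈ S.domain),
      ⟪(B ⟨x, hxB⟩ : H), (B ⟨y, hyB⟩ : H)⟫ = ⟪(S ⟨x, hxS⟩ : H), (S ⟨y, hyS⟩ : H)⟫)
    (C : H →L[ℂ] H) (hCsa : IsSelfAdjoint C)
    (hC : ∀ (u z : H) (huB : u ∈ B.domain) (huS : u ∈ S.domain) (hzB : z ∈ B.domain),
      (B ⟨z, hzB⟩ : H) = S ⟨u, huS⟩ → C (B ⟨u, huB⟩) = z)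
    (lam : ℂ) (hlam : lam ≠ 0)
    (u : H) (hu : u ∈ S.domain) (huB : u ∈ B.domain)
    (hSu : (S ⟨u, hu⟩ : H) ∈ S.adjoint.domain) :
    S.adjoint ⟨S ⟨u, hu⟩, hSu⟩ = lam • (S ⟨u, hu⟩ : H) ↔
      C (B ⟨u, huB⟩) = lam⁻¹ • (B ⟨u, huB⟩ : H) := by
  have hdB : Dense (B.domain : Set H) := by rw [hBdom]; exact hS.dense
  have hb : ∀ x : B.domain, ε * ‖(x : H)‖ ≤ ‖B x‖ := by
    rintro ⟨x, hx⟩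
    have hxS : x ∈ S.domain := hBdom ▸ hx
    have h1 : ‖B ⟨x, hx⟩‖ = ‖S ⟨x, hxS⟩‖ := by
      have := hBsq x x hx hxS hx hxS
      rw [inner_self_eq_norm_sq_to_K, inner_self_eq_norm_sq_to_K] at this
      have h2 : ‖B ⟨x, hx⟩‖ ^ 2 = ‖S ⟨x, hxS⟩‖ ^ 2 := by exact_mod_cast this
      exact (sq_eq_sq₀ (norm_nonneg _) (norm_nonneg _)).1 h2
    rw [h1]
    have h3 := hS.lower ⟨x, hxS⟩
    have h4 : (⟪x, (S ⟨x, hxS⟩ : H)⟫).re ≤ ‖x‖ * ‖S ⟨x, hxS⟩‖ :=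
      (Complex.re_le_norm _).trans (norm_inner_le_norm _ _)
    simp only at h3 ⊢
    rcases (norm_nonneg x).eq_or_lt with h0 | h0
    · rw [← h0, mul_zero]; exact norm_nonneg _
    · refine le_of_mul_le_mul_left ?_ h0
      nlinarith
  obtain ⟨hBu, hBB⟩ := aux_graph B hdB hBsa (B ⟨u, huB⟩) (S.adjoint ⟨S ⟨u, hu⟩, hSu⟩) (by
    rintro ⟨v, hv⟩
    have hvS : v ∈ S.domain := hBdom ▸ hv
    rw [hBsq u v huB hu hv hvS]
    exact LinearPMap.adjoint_isFormalAdjoint hS.dense ⟨_, hSu⟩ ⟨v, hvS⟩)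
  rw [← hBB]
  constructor
  · intro h
    apply hC u _ huB hu (B.domain.smul_mem _ hBu)
    have := B.map_smul lam⁻¹ ⟨_, hBu⟩
    rw [h, smul_smul, inv_mul_cancel₀ hlam, one_smul] at this
    exact this
  · intro h
    obtain ⟨⟨z, hz⟩, hzu⟩ := aux_surj B hdB hBsa ε hS.pos hb (S ⟨u, hu⟩)
    have h1 := hC u z huB hu hz hzu
    rw [h] at h1
    subst h1
    rw [← hzu]
    have := B.map_smul lam⁻¹ ⟨_, hBu⟩
    have h2 : B ⟨lam⁻¹ • (B ⟨u, huB⟩ : H), hz⟩ = lam⁻¹ • B ⟨_, hBu⟩ := this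
    rw [h2, smul_smul, mul_inv_cancel₀ hlam, one_smul]
end
end
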